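/- Cosine-sine decomposition: for every 2m×2m unitary matrix U there exist m×m unitary matrices L, L', R, R' and real angles θ₁,…,θₘ such that U = (L ⊕ L') · S(θ₁,…,θₘ) · (R† ⊕ R'†), where S(θ₁,…,θₘ) is the orthogonal block matrix [[diag(cos θᵢ), diag(sin θᵢ)],[−diag(sin θᵢ), diag(cos θᵢ)]]. -/

import Mathlib

open Matrix

namespace Matrix

open scoped ComplexOrder

variable {n 𝕜 : Type*} [Fintype n] [DecidableEq n] [RCLike 𝕜]

/-- A square matrix with pairwise orthogonal columns of norms `|d i|` is a unitary matrix times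
`diagonal d`. -/
theorem exists_unitary_mul_diagonal_of_conjTranspose_mul_self_eq (M : Matrix n n 𝕜) (d : n → ℝ)
    (h : Mᴴ * M = diagonal fun i => ((d i ^ 2 : ℝ) : 𝕜)) :
    ∃ V ∈ unitaryGroup n 𝕜, M = V * diagonal fun i => (d i : 𝕜) := by
  have hcol (i j : n) :
      ∑ k, star (M k i) * M k j = if i = j then ((d i ^ 2 : ℝ) : 𝕜) else 0 := by
    simpa [mul_apply, diagonal_apply] using congrFun₂ h i j
  let v (i : n) : EuclideanSpace 𝕜 n := WithLp.toLp 2 fun k => (d i : 𝕜)⁻¹ * M k i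
  have hv : Orthonormal 𝕜 ({i | d i ≠ 0}.domRestrict v) := by
    rw [orthonormal_iff_ite]
    rintro ⟨i, hi : d i ≠ 0⟩ ⟨j, hj⟩
    have hi' : (d i : 𝕜) ≠ 0 := by exact_mod_cast hi
    have hin : inner 𝕜 (v i) (v j) =
        (d i : 𝕜)⁻¹ * (d j : 𝕜)⁻¹ * ∑ k, star (M k i) * M k j := by
      rw [PiLp.inner_apply, Finset.mul_sum]
      refine Finset.sum_congr rfl fun k _ => ?_
      simp [v]
      ring
    change inner 𝕜 (v i) (v j) = _
    simp only [hin, hcol, Subtype.mk.injEq]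
    split_ifs with hij
    · subst hij
      push_cast
      field_simp
    · simp
  obtain ⟨b, hb⟩ := hv.exists_orthonormalBasis_extension_of_card_eq (by simp)
  refine ⟨of fun k i => b i k, ?_, ?_⟩
  · rw [mem_unitaryGroup_iff']
    ext i j
    have := orthonormal_iff_ite.mp b.orthonormal i j
    rw [PiLp.inner_apply] at this
    simpa [mul_apply, star_eq_conjTranspose, one_apply, mul_comm] using this
  · ext k i
    rw [mul_diagonal, of_apply]
    by_cases hi : d i = 0
    · have hzero : (fun l => M l i) = 0 := dotProduct_star_self_eq_zero.mp <| by
        simpa [dotProduct, mul_comm, hi] using hcol i i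
      simpa [hi] using congrFun hzero k
    · have hi' : (d i : 𝕜) ≠ 0 := by exact_mod_cast hi
      rw [hb i hi]
      simp only [v]
      field_simp

theorem nonneg_of_conjTranspose_mul_self_eq_diagonal (M : Matrix n n 𝕜) (e : n → ℝ)
    (h : Mᴴ * M = diagonal fun i => (e i : 𝕜)) (i : n) : 0 ≤ e i := by
  have := (h ▸ posSemidef_conjTranspose_mul_self M).diag_nonneg (i := i)
  rw [diagonal_apply_eq] at this
  exact_mod_cast this

theorem exists_unitary_conj_conjTranspose_mul_self_eq_diagonal (A : Matrix n n 𝕜) :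
    ∃ R ∈ unitaryGroup n 𝕜, ∃ e : n → ℝ,
      (∀ i, 0 ≤ e i) ∧ Rᴴ * (Aᴴ * A) * R = diagonal fun i => (e i : 𝕜) := by
  have hA := posSemidef_conjTranspose_mul_self A
  refine ⟨hA.1.eigenvectorUnitary, hA.1.eigenvectorUnitary.2, hA.1.eigenvalues,
    hA.eigenvalues_nonneg, ?_⟩
  have := hA.1.conjStarAlgAut_star_eigenvectorUnitary
  rw [Unitary.conjStarAlgAut_apply] at this
  simpa [star_eq_conjTranspose, Function.comp_def] using this

end Matrix

/-- Cosine-sine decomposition: every 2m×2m unitary matrix U factorizes as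
U = (L ⊕ L') · S(θ₁,…,θₘ) · (R† ⊕ R'†) with L, L', R, R' unitary m×m matrices and
S the cosine-sine matrix. -/
theorem cosine_sine_decomposition (m : ℕ)
    (U : Matrix (Fin m ⊕ Fin m) (Fin m ⊕ Fin m) ℂ)
    (hU : U ∈ Matrix.unitaryGroup (Fin m ⊕ Fin m) ℂ) :
    ∃ (L L' R R' : Matrix (Fin m) (Fin m) ℂ) (θ : Fin m → ℝ),
      L ∈ Matrix.unitaryGroup (Fin m) ℂ ∧ L' ∈ Matrix.unitaryGroup (Fin m) ℂ ∧
      R ∈ Matrix.unitaryGroup (Fin m) ℂ ∧ R' ∈ Matrix.unitaryGroup (Fin m) ℂ ∧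
      U = Matrix.fromBlocks L 0 0 L' *
          Matrix.fromBlocks
            (Matrix.diagonal fun i => (Real.cos (θ i) : ℂ))
            (Matrix.diagonal fun i => (Real.sin (θ i) : ℂ))
            (-(Matrix.diagonal fun i => (Real.sin (θ i) : ℂ)))
            (Matrix.diagonal fun i => (Real.cos (θ i) : ℂ)) *
          Matrix.fromBlocks Rᴴ 0 0 R'ᴴ := by
  obtain ⟨A, B, C, D, rfl⟩ : ∃ A B C D, U = fromBlocks A B C D :=
    ⟨_, _, _, _, (fromBlocks_toBlocks U).symm⟩
  have hU₁ := mem_unitaryGroup_iff.mp hU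
  have hU₂ := mem_unitaryGroup_iff'.mp hU
  rw [star_eq_conjTranspose, fromBlocks_conjTranspose, fromBlocks_multiply, ← fromBlocks_one,
    fromBlocks_inj] at hU₁ hU₂
  have hrow : B * Bᴴ = 1 - A * Aᴴ := eq_sub_of_add_eq' hU₁.1
  have hcolumn : Cᴴ * C = 1 - Aᴴ * A := eq_sub_of_add_eq' hU₂.1
  obtain ⟨R, hR, e, he₀, hRe⟩ := exists_unitary_conj_conjTranspose_mul_self_eq_diagonal A
  have hRR : Rᴴ * R = 1 := mem_unitaryGroup_iff'.mp hR
  have hRR' : R * Rᴴ = 1 := mem_unitaryGroup_iff.mp hR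
  have he₁ (i : Fin m) : e i ≤ 1 := by
    have h : (C * R)ᴴ * (C * R) = diagonal fun i => ((1 - e i : ℝ) : ℂ) := by
      rw [conjTranspose_mul, Matrix.mul_assoc, ← Matrix.mul_assoc Cᴴ, hcolumn, Matrix.sub_mul,
        Matrix.mul_sub, Matrix.one_mul, hRR, ← Matrix.mul_assoc, hRe, ← diagonal_one,
        diagonal_sub]
      simp
    exact sub_nonneg.mp (nonneg_of_conjTranspose_mul_self_eq_diagonal (C * R) _ h i)
  obtain ⟨θ, hθ⟩ : ∃ θ : Fin m → ℝ, ∀ i, Real.cos (θ i) ^ 2 = e i :=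
    ⟨fun i => Real.arccos √(e i), fun i => by
      rw [Real.cos_arccos (by linarith [Real.sqrt_nonneg (e i)]) (Real.sqrt_le_one.mpr (he₁ i)),
        Real.sq_sqrt (he₀ i)]⟩
  obtain ⟨L, hL, hAR⟩ := exists_unitary_mul_diagonal_of_conjTranspose_mul_self_eq (A * R)
    (fun i => Real.cos (θ i)) (by
      rw [conjTranspose_mul, Matrix.mul_assoc, ← Matrix.mul_assoc Aᴴ, ← Matrix.mul_assoc, hRe]
      simp_rw [hθ])
  have hLL : Lᴴ * L = 1 := mem_unitaryGroup_iff'.mp hL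
  have hLL' : L * Lᴴ = 1 := mem_unitaryGroup_iff.mp hL
  set c : Matrix (Fin m) (Fin m) ℂ := diagonal fun i => (Real.cos (θ i) : ℂ) with hc
  change A * R = L * c at hAR
  set s : Matrix (Fin m) (Fin m) ℂ := diagonal fun i => (Real.sin (θ i) : ℂ) with hs
  have hcH : cᴴ = c := by simp [hc, diagonal_conjTranspose, Pi.star_def, -Complex.ofReal_cos]
  have hsH : sᴴ = s := by simp [hs, diagonal_conjTranspose, Pi.star_def, -Complex.ofReal_sin]
  have hcs : c * s = s * c := by simp [hc, hs, mul_comm]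
  have hcs₁ : c * c + s * s = 1 := by
    rw [hc, hs, diagonal_mul_diagonal, diagonal_mul_diagonal, diagonal_add, ← diagonal_one]
    congr 1
    funext i
    exact_mod_cast by nlinarith [Real.cos_sq_add_sin_sq (θ i)]
  have hLA : Lᴴ * A = c * Rᴴ := by
    rw [← Matrix.mul_one A, ← hRR', ← Matrix.mul_assoc A, hAR, Matrix.mul_assoc L,
      ← Matrix.mul_assoc, hLL, Matrix.one_mul]
  have hLB : (Bᴴ * L)ᴴ * (Bᴴ * L) = s * s := by
    have hAL : Aᴴ * L = R * c := by simpa [hcH] using congrArg conjTranspose hLA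
    rw [conjTranspose_mul, conjTranspose_conjTranspose, Matrix.mul_assoc, ← Matrix.mul_assoc B,
      hrow, Matrix.sub_mul, Matrix.mul_sub, Matrix.one_mul, hLL, Matrix.mul_assoc A, hAL,
      ← Matrix.mul_assoc, hLA, Matrix.mul_assoc, ← Matrix.mul_assoc Rᴴ, hRR, Matrix.one_mul]
    exact sub_eq_of_eq_add' hcs₁.symm
  obtain ⟨R', hR', hBL⟩ := exists_unitary_mul_diagonal_of_conjTranspose_mul_self_eq (Bᴴ * L)
    (fun i => Real.sin (θ i)) (by rw [hLB, hs, diagonal_mul_diagonal]; simp [sq])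
  change Bᴴ * L = R' * s at hBL
  have hRR₂ : R'ᴴ * R' = 1 := mem_unitaryGroup_iff'.mp hR'
  have hRR₂' : R' * R'ᴴ = 1 := mem_unitaryGroup_iff.mp hR'
  have hBR : B * R' = L * s := by
    have hLB' : Lᴴ * B = s * R'ᴴ := by simpa [hsH] using congrArg conjTranspose hBL
    rw [← Matrix.one_mul B, ← hLL', Matrix.mul_assoc L, hLB', Matrix.mul_assoc, Matrix.mul_assoc,
      hRR₂, Matrix.mul_one]
  have hRmem : fromBlocks R 0 0 R' ∈ unitaryGroup (Fin m ⊕ Fin m) ℂ := by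
    rw [mem_unitaryGroup_iff, star_eq_conjTranspose, fromBlocks_conjTranspose,
      fromBlocks_multiply]
    simp [hRR', hRR₂']
  have hSmem : fromBlocks c s (-s) c ∈ unitaryGroup (Fin m ⊕ Fin m) ℂ := by
    rw [mem_unitaryGroup_iff, star_eq_conjTranspose, fromBlocks_conjTranspose,
      fromBlocks_multiply]
    simp [hcH, hsH, hcs₁, hcs, add_comm (s * s)]
  have hprod : fromBlocks A B C D * fromBlocks R 0 0 R' * star (fromBlocks c s (-s) c) =
      fromBlocks L 0 (C * R * c + D * R' * s) (D * R' * c - C * R * s) := by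
    rw [star_eq_conjTranspose, fromBlocks_conjTranspose, fromBlocks_multiply, fromBlocks_multiply]
    simp only [conjTranspose_neg, hcH, hsH, Matrix.mul_zero, add_zero, zero_add, hAR, hBR,
      Matrix.mul_neg]
    congr 1
    · rw [Matrix.mul_assoc, Matrix.mul_assoc, ← Matrix.mul_add, hcs₁, Matrix.mul_one]
    · rw [Matrix.mul_assoc, Matrix.mul_assoc, hcs, neg_add_cancel]
    · abel
  have hmem := mul_mem (mul_mem hU hRmem) (Unitary.star_mem hSmem)
  rw [hprod, mem_unitaryGroup_iff, star_eq_conjTranspose, fromBlocks_conjTranspose,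
    fromBlocks_multiply, ← fromBlocks_one, fromBlocks_inj] at hmem
  obtain ⟨-, -, hX, hL'⟩ := hmem
  have hX₀ : C * R * c + D * R' * s = 0 := by
    have := congrArg (· * L) hX
    simpa [Matrix.mul_assoc, hLL] using this
  rw [hX₀] at hprod hL'
  refine ⟨L, D * R' * c - C * R * s, R, R', θ, hL, ?_, hR, hR', ?_⟩
  · rw [mem_unitaryGroup_iff, star_eq_conjTranspose]
    simpa using hL'
  · have hRblocks : fromBlocks Rᴴ 0 0 R'ᴴ = star (fromBlocks R 0 0 R') := by
      simp [star_eq_conjTranspose, fromBlocks_conjTranspose]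
    rw [← hprod, hRblocks, Matrix.mul_assoc _ (star _), mem_unitaryGroup_iff'.mp hSmem,
      Matrix.mul_one, Matrix.mul_assoc, mem_unitaryGroup_iff.mp hRmem, Matrix.mul_one]
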